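/- arXiv:1306.3519 — 2 statements merged into one kernel-verified Lean document; each statement's English description precedes it below -/
import Mathlib

section
/- Let k be a field, let V ⊆ kⁿ be a linear subspace, and let V^⊥ = {w ∈ kⁿ : Σ_{i=1}^{n} v_i w_i = 0 for all v ∈ V} be its orthogonal complement with respect to the standard bilinear form. Then the dual matroid of the linear matroid M(V) equals M(V^⊥); equivalently, a subset B ⊆ {1,…,n} is a base of M(V^⊥) if and only if its complement {1,…,n} ∖ B is a base of M(V). -/
/-- The `i`-th coordinate functional `f_i : V → k`, `f_i v = v i`, as an element of the dual
space of the subspace `V` of `ι → k`. -/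
def coordFn {k : Type*} [Field k] {ι : Type*} (V : Submodule k (ι → k)) (i : ι) :
    Module.Dual k V :=
  (LinearMap.proj i).comp V.subtype

/-- A set `I` of indices is independent in the linear matroid `M(V)` of the subspace
`V ⊆ kⁱ` if the coordinate functionals `f_i` for `i ∈ I` are linearly independent in `V*`. -/
def IndepCoords {k : Type*} [Field k] {ι : Type*} (V : Submodule k (ι → k)) (I : Set ι) :
    Prop :=
  LinearIndependent k fun i : I => coordFn V (i : ι)

/-- A base of the linear matroid `M(V)`: a maximal independent set. -/
def IsBaseCoords {k : Type*} [Field k] {ι : Type*} (V : Submodule k (ι → k)) (B : Set ι) :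
    Prop :=
  IndepCoords V B ∧ ∀ B' : Set ι, IndepCoords V B' → B ⊆ B' → B' = B

/-- The orthogonal complement `V^⊥ = {w ∈ kⁿ : ∑ i, v i * w i = 0 for all v ∈ V}` of a
subspace `V ⊆ kⁿ` with respect to the standard bilinear form. -/
def perp {k : Type*} [Field k] {n : ℕ} (V : Submodule k (Fin n → k)) :
    Submodule k (Fin n → k) where
  carrier := {w | ∀ v ∈ V, ∑ i, v i * w i = 0}
  add_mem' := by
    intro a b ha hb v hv
    simp only [Pi.add_apply, mul_add, Finset.sum_add_distrib, ha v hv, hb v hv, add_zero]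
  zero_mem' := by intro v _; simp
  smul_mem' := by
    intro c w hw v hv
    simp only [Pi.smul_apply, smul_eq_mul, mul_left_comm _ c, ← Finset.mul_sum, hw v hv,
      mul_zero]

theorem coordFn_mem_span_iff {k : Type*} [Field k] {ι : Type*} [Finite ι]
    (V : Submodule k (ι → k)) (B : Set ι)
    (j : ι) : coordFn V j ∈ Submodule.span k (coordFn V '' B) ↔
      ∀ v ∈ V, (∀ i ∈ B, v i = 0) → v j = 0 := by
  rw [Set.image_eq_range]
  refine ⟨fun h v hv hvB => ?_, fun h => mem_span_of_iInf_ker_le_ker fun v hv => ?_⟩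
  · have hle : Submodule.span k (Set.range fun i : B => coordFn V i) ≤
        LinearMap.ker (Module.Dual.eval k V ⟨v, hv⟩) := by
      rw [Submodule.span_le]
      rintro _ ⟨i, rfl⟩
      exact hvB i i.2
    exact hle h
  · exact h v v.2 fun i hi => (Submodule.mem_iInf _).1 hv ⟨i, hi⟩

theorem isBaseCoords_iff_forall_eq_zero {k : Type*} [Field k] {ι : Type*} [Finite ι]
    (V : Submodule k (ι → k))
    (B : Set ι) : IsBaseCoords V B ↔
      IndepCoords V B ∧ ∀ v ∈ V, (∀ i ∈ B, v i = 0) → v = 0 := by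
  refine and_congr_right fun hB => ⟨fun hmax v hv hvB => ?_, fun h B' hB' hBB' => ?_⟩
  · ext j
    by_cases hj : j ∈ B
    · exact hvB j hj
    · refine (coordFn_mem_span_iff V B j).1 ?_ v hv hvB
      by_contra hspan
      exact hj (hmax (insert j B) ((linearIndepOn_insert hj).2 ⟨hB, hspan⟩)
        (Set.subset_insert j B) ▸ Set.mem_insert j B)
  · refine Set.Subset.antisymm (fun j hj => ?_) hBB'
    by_contra hjB
    have hins : LinearIndepOn k (coordFn V) (insert j B) :=
      LinearIndepOn.mono hB' (Set.insert_subset hj hBB')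
    exact ((linearIndepOn_insert hjB).1 hins).2 ((coordFn_mem_span_iff V B j).2
      fun v hv hvB => congrFun (h v hv hvB) j)

theorem indepCoords_iff_perp {k : Type*} [Field k] {n : ℕ}
    (V : Submodule k (Fin n → k)) (B : Set (Fin n)) :
    IndepCoords V B ↔ ∀ w ∈ perp V, (∀ i ∉ B, w i = 0) → w = 0 := by
  classical
  have hsum (w : Fin n → k) (hw : ∀ i ∉ B, w i = 0) (v : Fin n → k) :
      ∑ i : B, w i * v i = ∑ i, v i * w i := by
    have hsubset := Finset.sum_subset (Finset.subset_univ (Finset.univ.filter (· ∈ B)))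
      (f := fun i => v i * w i) fun i _ hi => by
        rw [hw i fun hiB => hi (by simp [hiB]), mul_zero]
    rw [← hsubset, Finset.sum_subtype (p := (· ∈ B)) _ (by simp)]
    exact Finset.sum_congr rfl fun i _ => mul_comm _ _
  rw [IndepCoords, Fintype.linearIndependent_iff]
  refine ⟨fun h w hw hwB => ?_, fun h g hg i => ?_⟩
  · ext i
    by_cases hi : i ∈ B
    · refine h (fun i => w i) ?_ ⟨i, hi⟩
      ext v
      simpa [coordFn, hsum w hwB] using hw v v.2
    · exact hwB i hi
  · let w : Fin n → k := fun i => if hi : i ∈ B then g ⟨i, hi⟩ else 0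
    have hwB : ∀ i ∉ B, w i = 0 := fun i hi => dif_neg hi
    have hwg (i : B) : w i = g i := dif_pos i.2
    have hw : w ∈ perp V := fun v hv => by
      rw [← hsum w hwB]
      simpa [coordFn, hwg] using LinearMap.congr_fun hg ⟨v, hv⟩
    rw [← hwg, h w hw hwB, Pi.zero_apply]

theorem perp_perp {k : Type*} [Field k] {n : ℕ}
    (V : Submodule k (Fin n → k)) : perp (perp V) = V := by
  refine le_antisymm (fun v hv => ?_) fun v hv w hw => ?_
  · by_contra hvV
    obtain ⟨f, hfv, hfV⟩ := Submodule.exists_le_ker_of_notMem hvV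
    have hf (u : Fin n → k) : f u = ∑ i, u i * f (Pi.single i 1) := by
      conv_lhs => rw [pi_eq_sum_univ' u]
      simp only [map_sum, map_smul, smul_eq_mul]
    refine hfv ?_
    rw [hf]
    simpa only [mul_comm] using hv (fun i => f (Pi.single i 1)) fun u hu =>
      (hf u).symm.trans (hfV hu)
  · simpa only [mul_comm] using hw v hv

theorem isBaseCoords_iff_forall_perp {k : Type*} [Field k] {n : ℕ}
    (V : Submodule k (Fin n → k)) (B : Set (Fin n)) :
    IsBaseCoords V B ↔ (∀ w ∈ perp V, (∀ i ∉ B, w i = 0) → w = 0) ∧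
      ∀ v ∈ V, (∀ i ∈ B, v i = 0) → v = 0 := by
  rw [isBaseCoords_iff_forall_eq_zero, indepCoords_iff_perp]

/-- For a subspace `V ⊆ kⁿ`, the dual matroid of the linear matroid `M(V)` equals `M(V^⊥)`:
a subset `B ⊆ {1,…,n}` is a base of `M(V^⊥)` if and only if its complement is a base of
`M(V)`. -/
theorem dual_linear_matroid_eq_perp {k : Type*} [Field k] {n : ℕ}
    (V : Submodule k (Fin n → k)) (B : Set (Fin n)) :
    IsBaseCoords (perp V) B ↔ IsBaseCoords V Bᶜ := by
  rw [isBaseCoords_iff_forall_perp, isBaseCoords_iff_forall_perp, perp_perp, and_comm]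
  simp only [Set.mem_compl_iff, not_not]
end

section
/- Let L be a finite lattice with bottom element ⊥, let G be a building set of L, let S be a nested set for G, and let Y_1, …, Y_k be pairwise incomparable elements of S with k ≥ 2. Set Y = Y_1 ∨ ⋯ ∨ Y_k. Then the maximal elements of {Z ∈ G : Z ≤ Y} are exactly Y_1, …, Y_k. -/
/-- The maximal elements of `{Y ∈ G : Y ≤ X}` in a lattice. -/
def maxUnder {L : Type*} [Lattice L] (G : Set L) (X : L) : Set L :=
  {Y | Y ∈ G ∧ Y ≤ X ∧ ∀ Z ∈ G, Z ≤ X → Y ≤ Z → Y = Z}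

/-- The join of the family `y` indexed by the maximal elements of `{Y ∈ G : Y ≤ X}`. -/
noncomputable def famJoin {L : Type*} [Lattice L] [OrderBot L] [Fintype L]
    (G : Set L) (X : L) (y : L → L) : L :=
  ((maxUnder G X).toFinite.toFinset).sup y

/-- `G ⊆ L ∖ {⊥}` is a building set of the finite lattice `L`: for every `X ≠ ⊥`, writing
`G_1, …, G_k` for the maximal elements of `{Y ∈ G : Y ≤ X}`, the join map from
`[⊥,G_1] × ⋯ × [⊥,G_k]` to `[⊥,X]` is an order isomorphism (i.e. it is surjective onto
`[⊥,X]`, and pointwise comparison of families corresponds to comparison of their joins). -/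
def IsBuildingSet {L : Type*} [Lattice L] [OrderBot L] [Fintype L] (G : Set L) : Prop :=
  ⊥ ∉ G ∧ ∀ X : L, X ≠ ⊥ →
    ((∀ Z ≤ X, ∃ y : L → L, (∀ F ∈ maxUnder G X, y F ≤ F) ∧ famJoin G X y = Z) ∧
      (∀ y y' : L → L, (∀ F ∈ maxUnder G X, y F ≤ F) → (∀ F ∈ maxUnder G X, y' F ≤ F) →
        ((∀ F ∈ maxUnder G X, y F ≤ y' F) ↔ famJoin G X y ≤ famJoin G X y')))

/-- `S` is a nested set for the building set `G`: `S ⊆ G`, and for any `k ≥ 2` pairwise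
incomparable elements of `S`, their join is not an element of `G`. -/
def IsNestedSet {L : Type*} [Lattice L] [OrderBot L] [Fintype L] (G S : Set L) : Prop :=
  S ⊆ G ∧ ∀ T : Finset L, ↑T ⊆ S → 2 ≤ T.card →
    ((T : Set L).Pairwise fun a b => ¬ a ≤ b ∧ ¬ b ≤ a) → T.sup id ∉ G

/-- Every element of `G` below `X` lies below a maximal one. -/
lemma exists_le_mem_maxUnder {L : Type*} [Lattice L] [Finite L] {G : Set L} {X Z : L}
    (hZ : Z ∈ G) (hZX : Z ≤ X) : ∃ F ∈ maxUnder G X, Z ≤ F := by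
  obtain ⟨F, hZF, hF⟩ := (Set.toFinite {W | W ∈ G ∧ W ≤ X}).exists_le_maximal
    (show Z ∈ {W | W ∈ G ∧ W ≤ X} from ⟨hZ, hZX⟩)
  exact ⟨F, ⟨hF.prop.1, hF.prop.2, fun W hW hWX hFW =>
    le_antisymm hFW (hF.le_of_ge ⟨hW, hWX⟩ hFW)⟩, hZF⟩

/-- If elements of a building set `G` have join `X`, then each maximal element `F` of
`{Z ∈ G : Z ≤ X}` is the join of those of them that lie below `F`. -/
lemma IsBuildingSet.sup_filter_le_eq {L ι : Type*} [Lattice L] [OrderBot L] [Fintype L]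
    {G : Set L} (hG : IsBuildingSet G) (s : Finset ι) (Y : ι → L) (hY : ∀ a ∈ s, Y a ∈ G)
    [DecidableLE L] {F : L} (hF : F ∈ maxUnder G (s.sup Y)) :
    (s.filter fun a => Y a ≤ F).sup Y = F := by
  have hle : ∀ E : L, (s.filter fun a => Y a ≤ E).sup Y ≤ E := fun E =>
    Finset.sup_le fun a ha => (Finset.mem_filter.1 ha).2
  have hX : s.sup Y ≠ ⊥ := fun h =>
    hG.1 (le_bot_iff.1 (h ▸ hF.2.1) ▸ hF.1)
  refine le_antisymm (hle F) (((hG.2 _ hX).2 id (fun E => (s.filter fun a => Y a ≤ E).sup Y)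
    (fun E _ => le_rfl) (fun E _ => hle E)).2 ?_ F hF)
  refine (Finset.sup_le fun E hE => ((Set.Finite.mem_toFinset _).1 hE).2.1).trans
    (Finset.sup_le fun a ha => ?_)
  obtain ⟨E, hE, haE⟩ := exists_le_mem_maxUnder (hY a ha) (Finset.le_sup ha)
  exact (Finset.le_sup (f := Y) (Finset.mem_filter.2 ⟨ha, haE⟩)).trans
    (Finset.le_sup (f := fun E => (s.filter fun a => Y a ≤ E).sup Y)
      ((Set.Finite.mem_toFinset _).2 hE))

/-- Let `L` be a finite lattice, `G` a building set of `L`, `S` a nested set for `G`, and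
`Y_1, …, Y_k` pairwise incomparable elements of `S` with `k ≥ 2`.  Then the maximal elements
of `{Z ∈ G : Z ≤ Y_1 ∨ ⋯ ∨ Y_k}` are exactly `Y_1, …, Y_k`. -/
theorem maxUnder_join_of_incomparable {L : Type*} [Lattice L] [OrderBot L] [Fintype L]
    (G S : Set L) (hG : IsBuildingSet G) (hS : IsNestedSet G S)
    (k : ℕ) (hk : 2 ≤ k) (Y : Fin k → L) (hmem : ∀ a, Y a ∈ S)
    (hinj : Function.Injective Y)
    (hinc : ∀ a b : Fin k, a ≠ b → ¬ Y a ≤ Y b) :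
    maxUnder G (Finset.univ.sup Y) = Set.range Y := by
  classical
  have hsub : maxUnder G (Finset.univ.sup Y) ⊆ Set.range Y := by
    intro F hF
    have hJ := hG.sup_filter_le_eq Finset.univ Y (fun a _ => hS.1 (hmem a)) hF
    set t := Finset.univ.filter fun a => Y a ≤ F
    have hcard : t.card < 2 := by
      by_contra! h2
      refine hS.2 (t.image Y) ?_ (by rwa [Finset.card_image_of_injective _ hinj]) ?_ ?_
      · intro Z hZ
        obtain ⟨a, -, rfl⟩ := Finset.mem_image.1 hZ
        exact hmem a
      · intro Z hZ W hW hne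
        obtain ⟨a, -, rfl⟩ := Finset.mem_image.1 hZ
        obtain ⟨b, -, rfl⟩ := Finset.mem_image.1 hW
        have hab : a ≠ b := fun h => hne (h ▸ rfl)
        exact ⟨hinc a b hab, hinc b a hab.symm⟩
      · rw [Finset.sup_image, Function.id_comp, hJ]
        exact hF.1
    have hne : t.Nonempty := by
      rw [Finset.nonempty_iff_ne_empty]
      intro h
      rw [h, Finset.sup_empty] at hJ
      exact hG.1 (hJ ▸ hF.1)
    obtain ⟨a, ha⟩ := Finset.card_eq_one.1 (le_antisymm (Nat.le_of_lt_succ hcard) hne.card_pos)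
    rw [ha, Finset.sup_singleton] at hJ
    exact ⟨a, hJ⟩
  refine hsub.antisymm ?_
  rintro _ ⟨a, rfl⟩
  obtain ⟨F, hF, haF⟩ := exists_le_mem_maxUnder (hS.1 (hmem a))
    (Finset.le_sup (f := Y) (Finset.mem_univ a))
  obtain ⟨b, rfl⟩ := hsub hF
  obtain rfl : a = b := by
    by_contra h
    exact hinc a b h haF
  exact hF
end
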